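/- Andrews' identity for the sums of three triangular numbers: (∑_{n=0}^∞ q^{n(n+1)/2})³ = ∑_{n=0}^∞ ∑_{j=0}^{2n} [(1 + q^{2n+1}) / (1 − q^{2n+1})] q^{2n² + 2n − j(j+1)/2}. -/

import Mathlib

open scoped BigOperators

/-- The finite q-shifted factorial `(a; q)_n`. -/
noncomputable def qPoch (q a : ℂ) (n : ℕ) : ℂ :=
  ∏ k ∈ Finset.range n, (1 - a * q ^ k)

/-- The infinite q-shifted factorial `(a; q)_∞`. -/
noncomputable def qPochInf (q a : ℂ) : ℂ :=
  ∏' k : ℕ, (1 - a * q ^ k)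

/-- The `n`-th term of the basic hypergeometric series `₃φ₂`.
(For `₃φ₂` the factor `((-1)^n q^(n(n-1)/2))^(1+s-r)` is `1`.) -/
noncomputable def phi32term (q a₁ a₂ a₃ b₁ b₂ z : ℂ) (n : ℕ) : ℂ :=
  qPoch q a₁ n * qPoch q a₂ n * qPoch q a₃ n /
    (qPoch q q n * qPoch q b₁ n * qPoch q b₂ n) * z ^ n

/-- The basic hypergeometric series `₃φ₂(a₁,a₂,a₃; b₁,b₂; q, z)`. -/
noncomputable def phi32 (q a₁ a₂ a₃ b₁ b₂ z : ℂ) : ℂ :=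
  ∑' n : ℕ, phi32term q a₁ a₂ a₃ b₁ b₂ z n

/-- The `n`-th term of the basic hypergeometric series `₄φ₃`. -/
noncomputable def phi43term (q a₁ a₂ a₃ a₄ b₁ b₂ b₃ z : ℂ) (n : ℕ) : ℂ :=
  qPoch q a₁ n * qPoch q a₂ n * qPoch q a₃ n * qPoch q a₄ n /
    (qPoch q q n * qPoch q b₁ n * qPoch q b₂ n * qPoch q b₃ n) * z ^ n

/-- The basic hypergeometric series `₄φ₃(a₁,a₂,a₃,a₄; b₁,b₂,b₃; q, z)`. -/
noncomputable def phi43 (q a₁ a₂ a₃ a₄ b₁ b₂ b₃ z : ℂ) : ℂ :=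
  ∑' n : ℕ, phi43term q a₁ a₂ a₃ a₄ b₁ b₂ b₃ z n

open Filter Topology

/-- The reciprocal `1 / (q; q)_n`, extended by zero to negative `n`. -/
noncomputable def invQPoch (q : ℂ) : ℤ → ℂ
  | .ofNat n => (qPoch q q n)⁻¹
  | .negSucc _ => 0

lemma qPoch_succ (q a : ℂ) (n : ℕ) : qPoch q a (n + 1) = qPoch q a n * (1 - a * q ^ n) :=
  Finset.prod_range_succ _ _

lemma one_sub_mul_pow_ne_zero {q a : ℂ} (hq : ‖q‖ < 1) (ha : ‖a‖ < 1) (n : ℕ) :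
    1 - a * q ^ n ≠ 0 := by
  intro h
  have h1 : ‖a * q ^ n‖ = 1 := by rw [← sub_eq_zero.mp h, norm_one]
  have h2 : ‖q‖ ^ n ≤ 1 := pow_le_one₀ (norm_nonneg _) hq.le
  rw [norm_mul, norm_pow] at h1
  nlinarith [norm_nonneg a]

lemma qPoch_ne_zero {q a : ℂ} (hq : ‖q‖ < 1) (ha : ‖a‖ < 1) (n : ℕ) : qPoch q a n ≠ 0 :=
  Finset.prod_ne_zero_iff.mpr fun k _ => one_sub_mul_pow_ne_zero hq ha k

lemma tendsto_qPoch {q a : ℂ} (hq : ‖q‖ < 1) (ha : ‖a‖ < 1) :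
    ∃ l : ℂ, l ≠ 0 ∧ Tendsto (qPoch q a) atTop (𝓝 l) := by
  have hs : Summable fun k : ℕ => ‖-(a * q ^ k)‖ := by
    simp only [norm_neg, norm_mul, norm_pow]
    exact (summable_geometric_of_lt_one (norm_nonneg _) hq).mul_left _
  refine ⟨∏' k : ℕ, (1 + -(a * q ^ k)), tprod_one_add_ne_zero_of_summable (fun k => ?_) hs, ?_⟩
  · simpa [sub_eq_add_neg] using one_sub_mul_pow_ne_zero hq ha k
  · have h := (multipliable_one_add_of_summable hs).tendsto_prod_tprod_nat
    simp only [← sub_eq_add_neg] at h ⊢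
    exact h

lemma exists_norm_le_of_tendsto {u : ℕ → ℂ} {l : ℂ} (h : Tendsto u atTop (𝓝 l)) :
    ∃ C : ℝ, ∀ n, ‖u n‖ ≤ C := by
  obtain ⟨C, hC⟩ := isBounded_iff_forall_norm_le.mp (Metric.isBounded_range_of_tendsto u h)
  exact ⟨C, fun n => hC _ ⟨n, rfl⟩⟩

lemma invQPoch_natCast (q : ℂ) (n : ℕ) : invQPoch q n = (qPoch q q n)⁻¹ := rfl

lemma invQPoch_of_neg (q : ℂ) {n : ℤ} (hn : n < 0) : invQPoch q n = 0 := by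
  cases n with
  | ofNat n => exact absurd hn (by simp)
  | negSucc n => rfl

lemma invQPoch_natCast_sub_one {q : ℂ} (hq : ‖q‖ < 1) (n : ℕ) :
    invQPoch q ((n : ℤ) - 1) = (1 - q ^ n) * invQPoch q n := by
  cases n with
  | zero => simp [invQPoch_of_neg]
  | succ n =>
    have h1 := one_sub_mul_pow_ne_zero hq hq n
    have h2 := qPoch_ne_zero hq hq n
    rw [show ((n + 1 : ℕ) : ℤ) - 1 = (n : ℤ) by push_cast; ring, invQPoch_natCast,
      invQPoch_natCast, qPoch_succ, pow_succ']
    field_simp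

/-! ### The Rogers–Szegő sum -/

lemma invQPoch_convolution_succ {q : ℂ} (hq : ‖q‖ < 1) (n : ℕ) :
    (1 - q ^ (n + 1)) * ∑ p ∈ Finset.HasAntidiagonal.antidiagonal (n + 1),
        q ^ p.1 * invQPoch (q ^ 2) p.1 * invQPoch (q ^ 2) p.2 =
      ∑ p ∈ Finset.HasAntidiagonal.antidiagonal n, q ^ p.1 * invQPoch (q ^ 2) p.1 * invQPoch (q ^ 2) p.2 := by
  have hq2 : ‖q ^ 2‖ < 1 := by
    rw [norm_pow]; exact pow_lt_one₀ (norm_nonneg _) hq two_ne_zero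
  have key : q ^ (n + 1) * ∑ p ∈ Finset.HasAntidiagonal.antidiagonal (n + 1),
        q ^ p.1 * invQPoch (q ^ 2) p.1 * invQPoch (q ^ 2) p.2 =
      ∑ p ∈ Finset.HasAntidiagonal.antidiagonal (n + 1), q ^ p.1 * invQPoch (q ^ 2) p.1 *
        (invQPoch (q ^ 2) p.2 - invQPoch (q ^ 2) ((p.2 : ℤ) - 1)) := by
    rw [← Finset.Nat.sum_antidiagonal_swap, Finset.mul_sum]
    refine Finset.sum_congr rfl fun p hp => ?_
    rw [invQPoch_natCast_sub_one hq2, ← Finset.HasAntidiagonal.mem_antidiagonal.mp hp]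
    simp only [Prod.fst_swap, Prod.snd_swap]
    ring
  rw [one_sub_mul, key, ← Finset.sum_sub_distrib, Finset.Nat.sum_antidiagonal_succ']
  simp only [Nat.cast_zero, Nat.cast_add, Nat.cast_one, add_sub_cancel_right]
  rw [invQPoch_of_neg _ (show (0 : ℤ) - 1 < 0 by norm_num)]
  simp only [sub_zero, sub_self, zero_add, ← mul_sub, sub_sub_cancel]

lemma sum_invQPoch_convolution {q : ℂ} (hq : ‖q‖ < 1) (n : ℕ) :
    ∑ p ∈ Finset.HasAntidiagonal.antidiagonal n, q ^ p.1 * invQPoch (q ^ 2) p.1 * invQPoch (q ^ 2) p.2 =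
      (qPoch q q n)⁻¹ := by
  induction n with
  | zero => simp [invQPoch_natCast, qPoch, -CharP.cast_eq_zero]
  | succ n ih =>
    have h1 := one_sub_mul_pow_ne_zero hq hq n
    have h := invQPoch_convolution_succ hq n
    rw [ih] at h
    rw [qPoch_succ, mul_inv, ← h, ← pow_succ']
    rw [← pow_succ'] at h1
    field_simp

lemma qPoch_two_mul (q : ℂ) (n : ℕ) :
    qPoch q q (2 * n) = qPoch (q ^ 2) q n * qPoch (q ^ 2) (q ^ 2) n := by
  induction n with
  | zero => simp [qPoch]
  | succ n ih =>
    rw [show 2 * (n + 1) = 2 * n + 1 + 1 by ring, qPoch_succ, qPoch_succ, ih, qPoch_succ,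
      qPoch_succ]
    ring

lemma sum_invQPoch_symm {q : ℂ} (hq : ‖q‖ < 1) (R : ℕ) :
    ∑ m ∈ Finset.range (R + 1),
        q ^ (R - m) * invQPoch (q ^ 2) ((R : ℤ) - m) * invQPoch (q ^ 2) ((R : ℤ) + m) +
      ∑ m ∈ Finset.range R, q ^ (R + 1 + m) * invQPoch (q ^ 2) ((R : ℤ) - (m + 1 : ℕ)) *
        invQPoch (q ^ 2) ((R : ℤ) + (m + 1 : ℕ)) =
      (qPoch q q (2 * R))⁻¹ := by
  rw [← sum_invQPoch_convolution hq, Finset.Nat.sum_antidiagonal_eq_sum_range_succ_mk,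
    show (2 * R).succ = R + 1 + R by lia, Finset.sum_range_add _ (R + 1) R,
    ← Finset.sum_range_reflect _ (R + 1)]
  congr 1
  · refine Finset.sum_congr rfl fun m hm => ?_
    have hm := Finset.mem_range.mp hm
    have h1 : (R : ℤ) - (R + 1 - 1 - m : ℕ) = (m : ℕ) := by lia
    have h2 : (R : ℤ) + (R + 1 - 1 - m : ℕ) = ((2 * R - m : ℕ) : ℤ) := by lia
    rw [h1, h2, show R - (R + 1 - 1 - m) = m by lia]
  · refine Finset.sum_congr rfl fun m hm => ?_
    have hm := Finset.mem_range.mp hm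
    have h1 : (R : ℤ) - (m + 1 : ℕ) = ((2 * R - (R + 1 + m) : ℕ) : ℤ) := by lia
    have h2 : (R : ℤ) + (m + 1 : ℕ) = ((R + 1 + m : ℕ) : ℤ) := by lia
    rw [h1, h2]
    ring

/-! ### The finite form of the identity -/

/-- The inner sum `∑_{j ≤ 2m} q^{-j(j+1)/2}`. -/
noncomputable def negTriSum (q : ℂ) (m : ℕ) : ℂ :=
  ∑ j ∈ Finset.range (2 * m + 1), (q ^ (j * (j + 1) / 2))⁻¹

lemma two_mul_triangular (m : ℕ) : 2 * m * (2 * m + 1) / 2 = m * (2 * m + 1) := by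
  rw [mul_assoc, Nat.mul_div_cancel_left _ two_pos]

lemma two_mul_add_one_triangular (m : ℕ) :
    (2 * m + 1) * (2 * m + 1 + 1) / 2 = (m + 1) * (2 * m + 1) := by
  rw [show (2 * m + 1) * (2 * m + 1 + 1) = 2 * ((m + 1) * (2 * m + 1)) by ring,
    Nat.mul_div_cancel_left _ two_pos]

lemma negTriSum_succ (q : ℂ) (m : ℕ) :
    negTriSum q (m + 1) = negTriSum q m + (q ^ ((m + 1) * (2 * m + 1)))⁻¹ +
      (q ^ ((m + 1) * (2 * (m + 1) + 1)))⁻¹ := by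
  rw [negTriSum, show 2 * (m + 1) + 1 = 2 * m + 1 + 1 + 1 by ring, Finset.sum_range_succ,
    Finset.sum_range_succ, two_mul_add_one_triangular, ← negTriSum,
    show 2 * m + 1 + 1 = 2 * (m + 1) by ring, two_mul_triangular]

lemma sum_sub_mul_negTriSum (q : ℂ) (T : ℕ → ℂ) (M : ℕ) :
    ∑ m ∈ Finset.range (M + 1), (T m - T (m + 1)) * negTriSum q m + T (M + 1) * negTriSum q M =
      ∑ m ∈ Finset.range (M + 1), T m * (q ^ (m * (2 * m + 1)))⁻¹ +
      ∑ m ∈ Finset.range M, T (m + 1) * (q ^ ((m + 1) * (2 * m + 1)))⁻¹ := by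
  induction M with
  | zero => simp [negTriSum]
  | succ M ih =>
    simp only [Finset.sum_range_succ, negTriSum_succ] at ih ⊢
    linear_combination ih

lemma bailey_pair_negTriSum {q : ℂ} (hq0 : q ≠ 0) (hq : ‖q‖ < 1) (R : ℕ) :
    q ^ R * ∑ m ∈ Finset.range (R + 1), (1 - q ^ (4 * m + 2)) * q ^ (2 * m ^ 2) * negTriSum q m *
      invQPoch (q ^ 2) ((R : ℤ) - m) * invQPoch (q ^ 2) ((R : ℤ) + m + 1) =
      (qPoch q q (2 * R))⁻¹ := by
  have hq2 : ‖q ^ 2‖ < 1 := by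
    rw [norm_pow]; exact pow_lt_one₀ (norm_nonneg _) hq two_ne_zero
  set T : ℕ → ℂ := fun m => q ^ (2 * m ^ 2) * invQPoch (q ^ 2) ((R : ℤ) - m) *
    invQPoch (q ^ 2) ((R : ℤ) + m) with hT
  have hT0 : T (R + 1) = 0 := by
    simp only [hT]
    rw [invQPoch_of_neg _ (show (R : ℤ) - (R + 1 : ℕ) < 0 by lia)]
    ring
  have hdiff : ∀ m ∈ Finset.range (R + 1), (1 - q ^ (4 * m + 2)) * q ^ (2 * m ^ 2) *
      negTriSum q m * invQPoch (q ^ 2) ((R : ℤ) - m) * invQPoch (q ^ 2) ((R : ℤ) + m + 1) =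
      (T m - T (m + 1)) * negTriSum q m := by
    intro m hm
    obtain ⟨d, rfl⟩ := Nat.exists_eq_add_of_le (Nat.lt_succ_iff.mp (Finset.mem_range.mp hm))
    have h1 := invQPoch_natCast_sub_one hq2 d
    have h2 := invQPoch_natCast_sub_one hq2 (m + d + m + 1)
    simp only [hT]
    rw [show ((m + d : ℕ) : ℤ) - m = (d : ℤ) by lia,
      show ((m + d : ℕ) : ℤ) - (m + 1 : ℕ) = (d : ℤ) - 1 by lia,
      show ((m + d : ℕ) : ℤ) + m = ((m + d + m + 1 : ℕ) : ℤ) - 1 by lia,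
      show ((m + d : ℕ) : ℤ) + (m + 1 : ℕ) = ((m + d + m + 1 : ℕ) : ℤ) by lia, h1, h2,
      sub_add_cancel]
    ring
  have h := sum_sub_mul_negTriSum q T R
  rw [hT0, zero_mul, add_zero] at h
  rw [Finset.sum_congr rfl hdiff, h, ← sum_invQPoch_symm hq, mul_add, Finset.mul_sum,
    Finset.mul_sum]
  congr 1
  · refine Finset.sum_congr rfl fun m hm => ?_
    obtain ⟨d, rfl⟩ := Nat.exists_eq_add_of_le (Nat.lt_succ_iff.mp (Finset.mem_range.mp hm))
    simp only [hT]
    rw [Nat.add_sub_cancel_left]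
    field_simp
    ring
  · refine Finset.sum_congr rfl fun m hm => ?_
    simp only [hT]
    field_simp
    ring

/-- The `m`-th summand of the double sum, with the inner sum carried out. -/
noncomputable def andrewsTerm (q : ℂ) (m : ℕ) : ℂ :=
  (1 + q ^ (2 * m + 1)) / (1 - q ^ (2 * m + 1)) * (q ^ (2 * m ^ 2 + 2 * m) * negTriSum q m)

lemma andrews_finite {q : ℂ} (hq0 : q ≠ 0) (hq : ‖q‖ < 1) (R : ℕ) :
    ∑ r ∈ Finset.range R, qPoch (q ^ 2) q r / qPoch (q ^ 2) (q ^ 2) r * q ^ r =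
      ∑ m ∈ Finset.range R, andrewsTerm q m * qPoch (q ^ 2) q R ^ 2 *
        invQPoch (q ^ 2) ((R : ℤ) - 1 - m) * invQPoch (q ^ 2) ((R : ℤ) + m) := by
  have hq2 : ‖q ^ 2‖ < 1 := by
    rw [norm_pow]; exact pow_lt_one₀ (norm_nonneg _) hq two_ne_zero
  induction R with
  | zero => simp
  | succ R ih =>
    have hext : ∑ m ∈ Finset.range R, andrewsTerm q m * qPoch (q ^ 2) q R ^ 2 *
        invQPoch (q ^ 2) ((R : ℤ) - 1 - m) * invQPoch (q ^ 2) ((R : ℤ) + m) =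
        ∑ m ∈ Finset.range (R + 1), andrewsTerm q m * qPoch (q ^ 2) q R ^ 2 *
        invQPoch (q ^ 2) ((R : ℤ) - 1 - m) * invQPoch (q ^ 2) ((R : ℤ) + m) := by
      rw [Finset.sum_range_succ, invQPoch_of_neg _ (show (R : ℤ) - 1 - R < 0 by lia)]
      ring
    have hstep : qPoch (q ^ 2) q R / qPoch (q ^ 2) (q ^ 2) R * q ^ R =
        qPoch (q ^ 2) q R ^ 2 * q ^ R * (qPoch q q (2 * R))⁻¹ := by
      rw [qPoch_two_mul]
      have h1 := qPoch_ne_zero hq2 hq R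
      have h2 := qPoch_ne_zero hq2 hq2 R
      field_simp
    rw [Finset.sum_range_succ, ih, hext, hstep, ← bailey_pair_negTriSum hq0 hq, Finset.mul_sum,
      Finset.mul_sum, ← Finset.sum_add_distrib]
    refine Finset.sum_congr rfl fun m hm => ?_
    obtain ⟨d, rfl⟩ := Nat.exists_eq_add_of_le (Nat.lt_succ_iff.mp (Finset.mem_range.mp hm))
    have h1 := invQPoch_natCast_sub_one hq2 d
    have h2 := invQPoch_natCast_sub_one hq2 (m + d + m + 1)
    have h3 := one_sub_mul_pow_ne_zero hq2 hq m
    rw [← pow_mul, ← pow_succ'] at h3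
    rw [show ((m + d : ℕ) : ℤ) - 1 - m = (d : ℤ) - 1 by lia,
      show ((m + d : ℕ) : ℤ) - m = (d : ℤ) by lia,
      show ((m + d + 1 : ℕ) : ℤ) - 1 - m = (d : ℤ) by lia,
      show ((m + d : ℕ) : ℤ) + m = ((m + d + m + 1 : ℕ) : ℤ) - 1 by lia,
      show ((m + d + 1 : ℕ) : ℤ) + m = ((m + d + m + 1 : ℕ) : ℤ) by lia, h1, h2,
      sub_add_cancel, qPoch_succ, andrewsTerm]
    field_simp
    ring

/-! ### The theta series as an infinite product -/

lemma qPoch_ratio_functional_eq {q : ℂ} (hq : ‖q‖ < 1) (z : ℂ) (K : ℕ) :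
    (1 - z * q) * ∑ s ∈ Finset.range (K + 1),
        qPoch (q ^ 2) q s / qPoch (q ^ 2) (q ^ 2) s * (z * q ^ 2) ^ s =
      (1 - z) * ∑ s ∈ Finset.range (K + 1),
        qPoch (q ^ 2) q s / qPoch (q ^ 2) (q ^ 2) s * z ^ s +
      z ^ (K + 1) * (qPoch (q ^ 2) q (K + 1) / qPoch (q ^ 2) (q ^ 2) K) := by
  have hq2 : ‖q ^ 2‖ < 1 := by
    rw [norm_pow]; exact pow_lt_one₀ (norm_nonneg _) hq two_ne_zero
  induction K with
  | zero => simp [qPoch]; ring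
  | succ K ih =>
    rw [Finset.sum_range_succ, mul_add, ih, Finset.sum_range_succ _ (K + 1),
      qPoch_succ _ _ (K + 1), qPoch_succ _ (q ^ 2) K]
    have h1 := qPoch_ne_zero hq2 hq2 K
    have h2 := one_sub_mul_pow_ne_zero hq2 hq2 K
    field_simp
    ring

lemma sum_triangular_eq {q : ℂ} (hq : ‖q‖ < 1) (N : ℕ) :
    ∑ n ∈ Finset.range (2 * N), q ^ (n * (n + 1) / 2) =
      qPoch (q ^ 2) (q ^ 2) N / qPoch (q ^ 2) q N * ∑ s ∈ Finset.range N,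
        qPoch (q ^ 2) q s / qPoch (q ^ 2) (q ^ 2) s * (q ^ (2 * N + 1)) ^ s := by
  have hq2 : ‖q ^ 2‖ < 1 := by
    rw [norm_pow]; exact pow_lt_one₀ (norm_nonneg _) hq two_ne_zero
  induction N with
  | zero => simp
  | succ N ih =>
    have h1 := qPoch_ne_zero hq2 hq2 N
    have h2 := qPoch_ne_zero hq2 hq N
    have h3 := one_sub_mul_pow_ne_zero hq2 hq N
    have h := qPoch_ratio_functional_eq hq (q ^ (2 * N + 1)) N
    conv_rhs at h => rw [Finset.sum_range_succ]
    rw [show q ^ (2 * (N + 1) + 1) = q ^ (2 * N + 1) * q ^ 2 by ring,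
      show 2 * (N + 1) = 2 * N + 1 + 1 by ring, Finset.sum_range_succ, Finset.sum_range_succ, ih,
      two_mul_triangular, two_mul_add_one_triangular, qPoch_succ, qPoch_succ,
      show q ^ 2 * (q ^ 2) ^ N = q ^ (2 * N + 1) * q by ring]
    rw [qPoch_succ] at h
    rw [show q * (q ^ 2) ^ N = q ^ (2 * N + 1) by ring] at h h3 ⊢
    rw [mul_div_mul_comm, mul_assoc, div_mul_eq_mul_div (1 - _), h]
    field_simp
    ring

lemma tendsto_tsum_mul_pow_one {b : ℕ → ℕ → ℂ} {z : ℕ → ℂ} {A r : ℝ} (hr0 : 0 ≤ r) (hr1 : r < 1)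
    (hb : ∀ N s, ‖b N s‖ ≤ A) (hb0 : Tendsto (fun N => b N 0) atTop (𝓝 1))
    (hz : ∀ N, ‖z N‖ ≤ r) (hz0 : Tendsto z atTop (𝓝 0)) :
    Tendsto (fun N => ∑' s, b N s * z N ^ s) atTop (𝓝 1) := by
  have h := tendsto_tsum_of_dominated_convergence (𝓕 := atTop)
    (f := fun N s => b N s * z N ^ s) (g := fun s => if s = 0 then (1 : ℂ) else 0)
    (bound := fun s => A * r ^ s) ((summable_geometric_of_lt_one hr0 hr1).mul_left A) ?_ ?_
  · simpa using h
  · intro s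
    rcases Nat.eq_zero_or_pos s with rfl | hs
    · simpa using hb0
    · rw [if_neg hs.ne']
      refine squeeze_zero_norm (a := fun N => A * ‖z N‖ ^ s) (fun N => ?_) ?_
      · rw [norm_mul, norm_pow]
        exact mul_le_mul_of_nonneg_right (hb N s) (by positivity)
      · simpa [hs.ne'] using ((hz0.norm.pow s).const_mul A)
  · refine Eventually.of_forall fun N s => ?_
    rw [norm_mul, norm_pow]
    exact mul_le_mul (hb N s) (pow_le_pow_left₀ (norm_nonneg _) (hz N) s) (by positivity)
      ((norm_nonneg _).trans (hb N s))

lemma summable_mul_pow_of_bounded {a : ℕ → ℂ} {A : ℝ} (ha : ∀ s, ‖a s‖ ≤ A) {z : ℂ}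
    (hz : ‖z‖ < 1) : Summable fun s => a s * z ^ s := by
  refine Summable.of_norm_bounded ((summable_geometric_of_lt_one (norm_nonneg z) hz).mul_left A)
    fun s => ?_
  rw [norm_mul, norm_pow]
  exact mul_le_mul_of_nonneg_right (ha s) (by positivity)

lemma summable_triangular {q : ℂ} (hq : ‖q‖ < 1) :
    Summable fun n : ℕ => q ^ (n * (n + 1) / 2) := by
  refine Summable.of_norm_bounded (summable_geometric_of_lt_one (norm_nonneg q) hq) fun n => ?_
  rw [norm_pow]
  refine pow_le_pow_of_le_one (norm_nonneg _) hq.le ?_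
  rw [Nat.le_div_iff_mul_le two_pos]
  rcases Nat.eq_zero_or_pos n with rfl | hn
  · simp
  · nlinarith

lemma tendsto_odd_pow {q : ℂ} (hq : ‖q‖ < 1) :
    Tendsto (fun N : ℕ => q ^ (2 * N + 1)) atTop (𝓝 0) :=
  (tendsto_pow_atTop_nhds_zero_of_norm_lt_one hq).comp
    (tendsto_atTop_mono (fun N : ℕ => (by lia : N ≤ 2 * N + 1)) tendsto_id)

lemma norm_odd_pow_le {q : ℂ} (hq : ‖q‖ < 1) (N : ℕ) : ‖q ^ (2 * N + 1)‖ ≤ ‖q‖ := by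
  rw [norm_pow]
  exact pow_le_of_le_one (norm_nonneg _) hq.le (by lia)

section ProductLimits

variable {q E O : ℂ}

lemma tsum_triangular_eq (hq : ‖q‖ < 1) (hO : O ≠ 0) (hE : E ≠ 0)
    (hOt : Tendsto (qPoch (q ^ 2) q) atTop (𝓝 O))
    (hEt : Tendsto (qPoch (q ^ 2) (q ^ 2)) atTop (𝓝 E)) :
    ∑' n : ℕ, q ^ (n * (n + 1) / 2) = E / O := by
  obtain ⟨A, hA⟩ := exists_norm_le_of_tendsto (hOt.div hEt hE)
  have hA0 : 0 ≤ A := (norm_nonneg _).trans (hA 0)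
  have h1 := tendsto_tsum_mul_pow_one (norm_nonneg q) hq
    (b := fun N s => if s < N then qPoch (q ^ 2) q s / qPoch (q ^ 2) (q ^ 2) s else 0)
    (z := fun N => q ^ (2 * N + 1)) (A := A) (fun N s => ?_) ?_ (norm_odd_pow_le hq)
    (tendsto_odd_pow hq)
  · have h2 := (hEt.div hOt hO).mul h1
    rw [mul_one] at h2
    have h3 := (summable_triangular hq).hasSum.tendsto_sum_nat.comp
      (tendsto_atTop_mono (fun N : ℕ => (by lia : N ≤ 2 * N)) tendsto_id)
    refine tendsto_nhds_unique h3 (h2.congr fun N => ?_)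
    simp only [Function.comp_apply, Pi.div_apply]
    rw [sum_triangular_eq hq, tsum_eq_sum (s := Finset.range N)]
    · congr 1
      refine Finset.sum_congr rfl fun s hs => ?_
      rw [if_pos (Finset.mem_range.mp hs)]
    · intro s hs
      rw [if_neg (by simpa using hs), zero_mul]
  · split_ifs
    · exact hA s
    · simpa using hA0
  · refine tendsto_const_nhds.congr' ?_
    filter_upwards [eventually_gt_atTop 0] with N hN
    simp [hN, qPoch]

lemma tsum_qPoch_ratio_functional_eq (hq : ‖q‖ < 1) {A : ℝ}
    (hA : ∀ s, ‖qPoch (q ^ 2) q s / qPoch (q ^ 2) (q ^ 2) s‖ ≤ A) {z : ℂ} (hz : ‖z‖ < 1) :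
    (1 - z * q) * ∑' s, qPoch (q ^ 2) q s / qPoch (q ^ 2) (q ^ 2) s * (z * q ^ 2) ^ s =
      (1 - z) * ∑' s, qPoch (q ^ 2) q s / qPoch (q ^ 2) (q ^ 2) s * z ^ s := by
  have hzq : ‖z * q ^ 2‖ < 1 := by
    rw [norm_mul, norm_pow]
    exact mul_lt_one_of_nonneg_of_lt_one_left (norm_nonneg _) hz
      (pow_le_one₀ (norm_nonneg _) hq.le)
  have h1 := ((summable_mul_pow_of_bounded hA hzq).hasSum.tendsto_sum_nat.comp
    (tendsto_add_atTop_nat 1)).const_mul (1 - z * q)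
  have h2 := ((summable_mul_pow_of_bounded hA hz).hasSum.tendsto_sum_nat.comp
    (tendsto_add_atTop_nat 1)).const_mul (1 - z)
  have h3 : Tendsto (fun K => z ^ (K + 1) *
      (qPoch (q ^ 2) q (K + 1) / qPoch (q ^ 2) (q ^ 2) K)) atTop (𝓝 0) := by
    have h4 := (summable_mul_pow_of_bounded hA hz).tendsto_atTop_zero
    have h5 : Tendsto (fun K => z * (1 - q * (q ^ 2) ^ K)) atTop (𝓝 (z * (1 - q * 0))) :=
      ((tendsto_const_nhds.sub ((tendsto_pow_atTop_nhds_zero_of_norm_lt_one (by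
        rw [norm_pow]; exact pow_lt_one₀ (norm_nonneg _) hq two_ne_zero)).const_mul q))).const_mul z
    have h6 := h4.mul h5
    rw [zero_mul] at h6
    refine h6.congr fun K => ?_
    rw [qPoch_succ]
    ring
  have h7 := h2.add h3
  rw [add_zero] at h7
  exact tendsto_nhds_unique h1 (h7.congr fun K => (qPoch_ratio_functional_eq hq z K).symm)

lemma tsum_qPoch_ratio_eq (hq : ‖q‖ < 1) (hO : O ≠ 0) (hE : E ≠ 0)
    (hOt : Tendsto (qPoch (q ^ 2) q) atTop (𝓝 O))
    (hEt : Tendsto (qPoch (q ^ 2) (q ^ 2)) atTop (𝓝 E)) :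
    ∑' s, qPoch (q ^ 2) q s / qPoch (q ^ 2) (q ^ 2) s * q ^ s = E / O := by
  have hq2 : ‖q ^ 2‖ < 1 := by
    rw [norm_pow]; exact pow_lt_one₀ (norm_nonneg _) hq two_ne_zero
  obtain ⟨A, hA⟩ := exists_norm_le_of_tendsto (hOt.div hEt hE)
  have h1 := tendsto_tsum_mul_pow_one (norm_nonneg q) hq
    (b := fun _ s => qPoch (q ^ 2) q s / qPoch (q ^ 2) (q ^ 2) s)
    (z := fun N => q ^ (2 * N + 1)) (A := A) (fun _ => hA) (by simp [qPoch])
    (norm_odd_pow_le hq) (tendsto_odd_pow hq)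
  have h2 := (hEt.div hOt hO).mul h1
  rw [mul_one] at h2
  refine tendsto_nhds_unique (tendsto_const_nhds.congr fun N => ?_) h2
  simp only [Pi.div_apply]
  induction N with
  | zero => simp [qPoch]
  | succ N ih =>
    have h3 := one_sub_mul_pow_ne_zero hq2 hq N
    have h4 := tsum_qPoch_ratio_functional_eq hq hA ((norm_odd_pow_le hq N).trans_lt hq)
    rw [ih, qPoch_succ, qPoch_succ, show q ^ 2 * (q ^ 2) ^ N = q ^ (2 * N + 1) * q by ring,
      show q ^ (2 * (N + 1) + 1) = q ^ (2 * N + 1) * q ^ 2 by ring]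
    rw [show q * (q ^ 2) ^ N = q ^ (2 * N + 1) by ring] at h3 ⊢
    rw [mul_div_mul_comm, mul_assoc, div_mul_eq_mul_div (1 - _), h4,
      mul_div_cancel_left₀ _ h3]

end ProductLimits

/-! ### The limit of the finite identity -/

lemma norm_pow_mul_negTriSum_le {q : ℂ} (hq0 : q ≠ 0) (hq : ‖q‖ < 1) (m : ℕ) :
    ‖q ^ (2 * m ^ 2 + 2 * m) * negTriSum q m‖ ≤ (2 * m + 1) * ‖q‖ ^ m := by
  rw [negTriSum, Finset.mul_sum]
  refine (norm_sum_le_of_le (f := _) (n := fun _ => ‖q‖ ^ m) _ fun j hj => ?_).trans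
    (by simp)
  have hj := Nat.lt_succ_iff.mp (Finset.mem_range.mp hj)
  have hle : j * (j + 1) / 2 ≤ m * (2 * m + 1) := by
    rw [← two_mul_triangular]
    gcongr
  obtain ⟨d, hd⟩ := Nat.exists_eq_add_of_le hle
  rw [show 2 * m ^ 2 + 2 * m = j * (j + 1) / 2 + (d + m) by rw [← add_assoc, ← hd]; ring, pow_add,
    mul_comm (q ^ _), mul_assoc, mul_inv_cancel₀ (pow_ne_zero _ hq0), mul_one, norm_pow]
  exact pow_le_pow_of_le_one (norm_nonneg _) hq.le (by lia)

lemma summable_norm_andrewsTerm {q : ℂ} (hq0 : q ≠ 0) (hq : ‖q‖ < 1) :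
    Summable fun m => ‖andrewsTerm q m‖ := by
  have hz := tendsto_odd_pow hq
  have hc := (hz.const_add 1).div (hz.const_sub 1) (by simp)
  obtain ⟨C, hC⟩ := exists_norm_le_of_tendsto hc
  have hs : Summable fun m : ℕ => C * ((2 * m + 1) * ‖q‖ ^ m) := by
    have h0 := summable_geometric_of_lt_one (norm_nonneg q) hq
    have h1 := summable_pow_mul_geometric_of_norm_lt_one 1
      (show ‖‖q‖‖ < 1 by rwa [norm_norm])
    refine (((h1.mul_left 2).add h0).congr fun m => ?_).mul_left C
    ring
  refine Summable.of_nonneg_of_le (fun _ => norm_nonneg _) (fun m => ?_) hs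
  rw [andrewsTerm, norm_mul]
  exact mul_le_mul (hC m) (norm_pow_mul_negTriSum_le hq0 hq m) (norm_nonneg _)
    ((norm_nonneg _).trans (hC m))

lemma tsum_andrewsTerm {q : ℂ} (hq0 : q ≠ 0) (hq : ‖q‖ < 1) :
    (∑' n : ℕ, q ^ (n * (n + 1) / 2)) ^ 3 = ∑' m, andrewsTerm q m := by
  have hq2 : ‖q ^ 2‖ < 1 := by
    rw [norm_pow]; exact pow_lt_one₀ (norm_nonneg _) hq two_ne_zero
  obtain ⟨O, hO, hOt⟩ := tendsto_qPoch hq2 hq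
  obtain ⟨E, hE, hEt⟩ := tendsto_qPoch hq2 hq2
  have hIt : Tendsto (fun n : ℕ => invQPoch (q ^ 2) n) atTop (𝓝 E⁻¹) := hEt.inv₀ hE
  obtain ⟨A, hA⟩ := exists_norm_le_of_tendsto (hOt.div hEt hE)
  obtain ⟨B, hB⟩ := exists_norm_le_of_tendsto hOt
  obtain ⟨C, hC⟩ := exists_norm_le_of_tendsto hIt
  have hB0 : 0 ≤ B := (norm_nonneg _).trans (hB 0)
  have hC0 : 0 ≤ C := (norm_nonneg _).trans (hC 0)
  have hC' : ∀ n : ℤ, ‖invQPoch (q ^ 2) n‖ ≤ C := by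
    intro n
    rcases lt_or_ge n 0 with hn | hn
    · simpa [invQPoch_of_neg _ hn] using hC0
    · lift n to ℕ using hn
      exact hC n
  have hleft := (summable_mul_pow_of_bounded hA hq).hasSum.tendsto_sum_nat
  have hright := tendsto_tsum_of_dominated_convergence (𝓕 := atTop)
    (f := fun R m : ℕ => andrewsTerm q m * qPoch (q ^ 2) q R ^ 2 *
      invQPoch (q ^ 2) ((R : ℤ) - 1 - m) * invQPoch (q ^ 2) ((R : ℤ) + m))
    (g := fun m => andrewsTerm q m * O ^ 2 * E⁻¹ * E⁻¹)
    (bound := fun m => ‖andrewsTerm q m‖ * B ^ 2 * C * C)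
    ((((summable_norm_andrewsTerm hq0 hq).mul_right _).mul_right _).mul_right _) ?_ ?_
  · have heq := tendsto_nhds_unique hleft (hright.congr fun R => ?_)
    · simp only [Pi.div_apply] at heq
      rw [tsum_qPoch_ratio_eq hq hO hE hOt hEt, tsum_mul_right, tsum_mul_right,
        tsum_mul_right] at heq
      rw [tsum_triangular_eq hq hO hE hOt hEt]
      field_simp at heq ⊢
      linear_combination heq
    · simp only [Pi.div_apply]
      rw [andrews_finite hq0 hq, tsum_eq_sum (s := Finset.range R)]
      intro m hm
      have hm : R ≤ m := by simpa using hm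
      rw [invQPoch_of_neg _ (show (R : ℤ) - 1 - m < 0 by lia)]
      ring
  · intro m
    refine (((hOt.pow 2).const_mul _).mul ?_).mul ?_
    · refine (hIt.comp (tendsto_sub_atTop_nat (m + 1))).congr' ?_
      filter_upwards [eventually_ge_atTop (m + 1)] with R hR
      rw [Function.comp_apply, show ((R - (m + 1) : ℕ) : ℤ) = (R : ℤ) - 1 - m by lia]
    · exact_mod_cast hIt.comp (tendsto_add_atTop_nat m)
  · refine Eventually.of_forall fun R m => ?_
    rw [norm_mul, norm_mul, norm_mul, norm_pow]
    gcongr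
    · exact hB R
    · exact hC' _
    · exact hC' _

theorem andrews_three_triangular_numbers
    (q : ℂ) (hq0 : 0 < ‖q‖) (hq1 : ‖q‖ < 1) :
    (∑' n : ℕ, q ^ (n * (n + 1) / 2)) ^ 3 =
      ∑' n : ℕ, ∑ j ∈ Finset.range (2 * n + 1),
        (1 + q ^ (2 * n + 1)) / (1 - q ^ (2 * n + 1)) *
          q ^ (2 * (n : ℤ) ^ 2 + 2 * (n : ℤ) - (j : ℤ) * ((j : ℤ) + 1) / 2) := by
  have hq : q ≠ 0 := norm_pos_iff.mp hq0
  rw [tsum_andrewsTerm hq hq1]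
  refine tsum_congr fun n => ?_
  rw [andrewsTerm, negTriSum, Finset.mul_sum, Finset.mul_sum]
  refine Finset.sum_congr rfl fun j _ => ?_
  rw [zpow_sub₀ hq, div_eq_mul_inv (q ^ (2 * (n : ℤ) ^ 2 + 2 * (n : ℤ)))]
  norm_cast
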